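/- Fix a probability measure D on Z, an integer m ≥ 1, a prior probability measure P on H, and δ ∈ (0,1). With probability at least 1−δ over the draw of an i.i.d. sample S ~ D^⊗m, simultaneously for every probability measure Q on H, writing c = (KL(Q‖P) + ln(2√m/δ)) / (2m), one has R_D(Q) ≤ ( √( R̂_S(Q) + c ) + √c )² (PAC-Bayes quadratic bound). -/

import Mathlib

open MeasureTheory ENNReal

open Classical in
/-- Kullback–Leibler divergence between measures, `+∞` if `Q` is not absolutely
continuous with respect to `P` (or if the log-likelihood ratio is not integrable,
in which case the divergence between probability measures is indeed infinite). -/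
noncomputable def klDiv' {α : Type*} [MeasurableSpace α] (Q P : Measure α) : ℝ≥0∞ :=
  if Q ≪ P ∧ Integrable (fun x => Real.log (Q.rnDeriv P x).toReal) Q
  then ENNReal.ofReal (∫ x, Real.log (Q.rnDeriv P x).toReal ∂Q)
  else ∞

/-- Population risk of a hypothesis `h`. -/
noncomputable def riskD {H Z : Type*} [MeasurableSpace Z] (ℓ : H → Z → ℝ)
    (D : Measure Z) (h : H) : ℝ := ∫ z, ℓ h z ∂D

/-- Empirical risk of a hypothesis `h` on the sample `S`. -/
noncomputable def riskS {H Z : Type*} (ℓ : H → Z → ℝ) {m : ℕ} (S : Fin m → Z) (h : H) : ℝ :=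
  (1 / (m : ℝ)) * ∑ j, ℓ h (S j)

/-- Population risk of a distribution `Q` over hypotheses. -/
noncomputable def riskDQ {H Z : Type*} [MeasurableSpace H] [MeasurableSpace Z]
    (ℓ : H → Z → ℝ) (D : Measure Z) (Q : Measure H) : ℝ := ∫ h, riskD ℓ D h ∂Q

/-- Empirical risk of a distribution `Q` over hypotheses on the sample `S`. -/
noncomputable def riskSQ {H Z : Type*} [MeasurableSpace H] (ℓ : H → Z → ℝ) {m : ℕ}
    (S : Fin m → Z) (Q : Measure H) : ℝ := ∫ h, riskS ℓ S h ∂Q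

/-- The lower bound `(p - q)₊² / (2p)` on the binary relative entropy `kl(q‖p)`. -/
noncomputable def quadGap (p q : ℝ) : ℝ := p * (max 0 ((p - q) / p)) ^ 2 / 2

lemma quadGap_nonneg {p : ℝ} (hp : 0 ≤ p) (q : ℝ) : 0 ≤ quadGap p q := by
  unfold quadGap; positivity

lemma max_sub_div_le_one {p q : ℝ} (hp : 0 ≤ p) (hq : 0 ≤ q) : max 0 ((p - q) / p) ≤ 1 :=
  max_le zero_le_one (div_le_one_of_le₀ (by linarith) hp)

lemma quadGap_le_half {p q : ℝ} (hp : 0 ≤ p) (hp1 : p ≤ 1) (hq : 0 ≤ q) :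
    quadGap p q ≤ 1 / 2 := by
  have h1 := max_sub_div_le_one hp hq
  have h0 : 0 ≤ max 0 ((p - q) / p) := le_max_left _ _
  have h2 : (max 0 ((p - q) / p)) ^ 2 ≤ 1 := pow_le_one₀ h0 h1
  unfold quadGap
  nlinarith [sq_nonneg (max 0 ((p - q) / p))]

lemma mul_sub_le_quadGap {p q l : ℝ} (hp : 0 ≤ p) (hq : 0 ≤ q) (hl : 0 ≤ l) :
    l * (p - q) - l ^ 2 * p / 2 ≤ quadGap p q := by
  unfold quadGap
  rcases hp.eq_or_lt with rfl | hp
  · simp only [zero_sub, zero_mul, zero_div, mul_zero, sub_zero]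
    nlinarith
  rcases le_total 0 ((p - q) / p) with h | h
  · rw [max_eq_right h]
    have : p - q = p * ((p - q) / p) := by field_simp
    generalize (p - q) / p = x at *
    rw [this]
    nlinarith [mul_nonneg hp.le (sq_nonneg (x - l))]
  · rw [max_eq_left h]
    have : p - q = p * ((p - q) / p) := by field_simp
    generalize (p - q) / p = x at *
    rw [this]
    nlinarith [mul_nonneg (mul_nonneg hl hp.le) (neg_nonneg.2 h), mul_nonneg hp.le (sq_nonneg l)]

lemma le_sq_sqrt_add_sqrt {p q c : ℝ} (hp : 0 ≤ p) (hq : 0 ≤ q) (hc : 0 ≤ c)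
    (h : ∀ l, 0 ≤ l → l * (p - q) - l ^ 2 * p / 2 ≤ 2 * c) :
    p ≤ (√(q + c) + √c) ^ 2 := by
  have key : p - q ≤ 2 * (√p * √c) := by
    rcases le_total p q with hpq | hpq
    · have : 0 ≤ √p * √c := by positivity
      linarith
    rcases hp.eq_or_lt with rfl | hp
    · simp; linarith
    have h1 := h ((p - q) / p) (div_nonneg (by linarith) hp.le)
    have h2 : (p - q) / p * (p - q) - ((p - q) / p) ^ 2 * p / 2 = (p - q) ^ 2 / (2 * p) := by
      field_simp; ring
    rw [h2, div_le_iff₀ (by positivity)] at h1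
    refine le_of_sq_le_sq ?_ (by positivity)
    rw [mul_pow, mul_pow, Real.sq_sqrt hp.le, Real.sq_sqrt hc]
    linarith
  have h3 : √p ≤ √(q + c) + √c := by
    have : √p - √c ≤ √(q + c) := by
      apply Real.le_sqrt_of_sq_le
      rw [sub_sq, Real.sq_sqrt hp, Real.sq_sqrt hc]
      linarith
    linarith
  calc p = √p ^ 2 := (Real.sq_sqrt hp).symm
    _ ≤ _ := by gcongr

lemma exp_neg_le_quadratic {y : ℝ} (hy : 0 ≤ y) : Real.exp (-y) ≤ 1 - y + y ^ 2 / 2 := by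
  have h := Real.quadratic_le_exp_of_nonneg hy
  have h0 : 0 < 1 - y + y ^ 2 / 2 := by nlinarith [sq_nonneg (y - 1)]
  rw [Real.exp_neg, inv_le_iff_one_le_mul₀ (Real.exp_pos _)]
  calc (1 : ℝ) ≤ (1 - y + y ^ 2 / 2) * (1 + y + y ^ 2 / 2) := by nlinarith [sq_nonneg (y ^ 2)]
    _ ≤ _ := by gcongr

lemma integral_exp_neg_mul_le {Z : Type*} [MeasurableSpace Z] (D : Measure Z)
    [IsProbabilityMeasure D] {f : Z → ℝ} (hf : Measurable f) (hf01 : ∀ z, f z ∈ Set.Icc (0 : ℝ) 1)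
    {l : ℝ} (hl : 0 ≤ l) :
    ∫ z, Real.exp (-(l * f z)) ∂D ≤
      Real.exp (-(l * ∫ z, f z ∂D) + l ^ 2 * (∫ z, f z ∂D) / 2) := by
  have hfi : Integrable f D := Integrable.of_mem_Icc 0 1 hf.aemeasurable (ae_of_all _ hf01)
  have hexp : Integrable (fun z => Real.exp (-(l * f z))) D := by
    refine Integrable.of_mem_Icc 0 1 (by fun_prop) (ae_of_all _ fun z => ⟨(Real.exp_pos _).le, ?_⟩)
    exact Real.exp_le_one_iff.2 (neg_nonpos.2 (mul_nonneg hl (hf01 z).1))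
  calc ∫ z, Real.exp (-(l * f z)) ∂D ≤ ∫ z, (1 + (-l + l ^ 2 / 2) * f z) ∂D := by
        refine integral_mono hexp ((integrable_const _).add (hfi.const_mul _)) fun z => ?_
        have h1 := exp_neg_le_quadratic (mul_nonneg hl (hf01 z).1)
        have h2 : f z ^ 2 ≤ f z := by nlinarith [(hf01 z).1, (hf01 z).2]
        have h3 := mul_le_mul_of_nonneg_left h2 (sq_nonneg l)
        simp only
        nlinarith
    _ = (-(l * ∫ z, f z ∂D) + l ^ 2 * (∫ z, f z ∂D) / 2) + 1 := by
        rw [integral_add (integrable_const _) (hfi.const_mul _), integral_const_mul]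
        simp; ring
    _ ≤ _ := Real.add_one_le_exp _

lemma lintegral_exp_linear_le_one {Z : Type*} [MeasurableSpace Z] (D : Measure Z)
    [IsProbabilityMeasure D] {f : Z → ℝ} (hf : Measurable f) (hf01 : ∀ z, f z ∈ Set.Icc (0 : ℝ) 1)
    {m : ℕ} (hm : 1 ≤ m) {l : ℝ} (hl : 0 ≤ l) :
    ∫⁻ S : Fin m → Z, ENNReal.ofReal (Real.exp (m * (l * ((∫ z, f z ∂D) -
      (1 / (m : ℝ)) * ∑ j, f (S j)) - l ^ 2 * (∫ z, f z ∂D) / 2)))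
        ∂(Measure.pi fun _ : Fin m => D) ≤ 1 := by
  set p := ∫ z, f z ∂D
  have hm0 : (m : ℝ) ≠ 0 := by positivity
  have key : ∀ S : Fin m → Z, Real.exp (m * (l * (p - (1 / (m : ℝ)) * ∑ j, f (S j)) -
      l ^ 2 * p / 2)) = Real.exp (l * p - l ^ 2 * p / 2) ^ m * ∏ j, Real.exp (-(l * f (S j))) := by
    intro S
    rw [← Real.exp_sum, ← Real.exp_nat_mul, ← Real.exp_add, Finset.sum_neg_distrib,
      ← Finset.mul_sum]
    congr 1
    field_simp
    ring
  simp_rw [key]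
  rw [← ofReal_integral_eq_lintegral_ofReal]
  · rw [integral_const_mul, integral_fintype_prod_eq_pow (fun z => Real.exp (-(l * f z))),
      Fintype.card_fin, ← mul_pow]
    refine ENNReal.ofReal_le_one.2 (pow_le_one₀ ?_ ?_)
    · exact mul_nonneg (Real.exp_pos _).le (integral_nonneg fun _ => (Real.exp_pos _).le)
    · calc _ ≤ Real.exp (l * p - l ^ 2 * p / 2) * Real.exp (-(l * p) + l ^ 2 * p / 2) := by
            gcongr
            exact integral_exp_neg_mul_le D hf hf01 hl
        _ = 1 := by rw [← Real.exp_add]; simp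
  · refine Integrable.const_mul ?_ _
    refine Integrable.of_mem_Icc 0 1 (Measurable.aemeasurable (by fun_prop))
      (ae_of_all _ fun S => ⟨by positivity, ?_⟩)
    exact Finset.prod_le_one (fun _ _ => (Real.exp_pos _).le) fun j _ =>
      Real.exp_le_one_iff.2 (neg_nonpos.2 (mul_nonneg hl (hf01 _).1))
  · exact ae_of_all _ fun S => by positivity

lemma exp_quadGap_le_integral {p q m : ℝ} (hp : 0 ≤ p) (hp1 : p ≤ 1) (hq : 0 ≤ q) (hm : 3 ≤ m) :
    Real.exp (m * quadGap p q) ≤ 1 + (2 * √m - 1) *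
      ∫ l in (0 : ℝ)..1, Real.exp (m * (l * (p - q) - l ^ 2 * p / 2)) := by
  have hs : √3 ≤ √m := Real.sqrt_le_sqrt hm
  have h3 : (1.73 : ℝ) ≤ √3 := Real.le_sqrt_of_sq_le (by norm_num)
  have hJ0 : 0 ≤ ∫ l in (0 : ℝ)..1, Real.exp (m * (l * (p - q) - l ^ 2 * p / 2)) :=
    intervalIntegral.integral_nonneg zero_le_one fun _ _ => (Real.exp_pos _).le
  have hcoef : 0 ≤ 2 * √m - 1 := by linarith
  unfold quadGap
  rcases hp.eq_or_lt with rfl | hp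
  · simp only [zero_mul, zero_div, mul_zero, Real.exp_zero]
    simpa using mul_nonneg hcoef hJ0
  rcases le_total ((p - q) / p) 0 with h | h
  · rw [max_eq_left h]
    norm_num
    exact mul_nonneg hcoef hJ0
  have hx1 := max_sub_div_le_one hp.le hq
  rw [max_eq_right h] at hx1 ⊢
  have hpx : p - q = p * ((p - q) / p) := by field_simp
  generalize (p - q) / p = x at *
  rw [hpx] at hJ0 ⊢
  set t := √3 / (2 * √m) with ht
  have hspos : 0 < √m := by linarith
  have hts : t * √m = √3 / 2 := by rw [ht]; field_simp
  have ht0 : 0 < t := by positivity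
  have ht2 : t ≤ 1 / 2 := by rw [ht, div_le_iff₀ (by positivity)]; linarith
  have hmt : m * t ^ 2 = 3 / 4 := by
    calc m * t ^ 2 = (t * √m) ^ 2 := by rw [mul_pow, Real.sq_sqrt (by linarith)]; ring
      _ = 3 / 4 := by rw [hts, div_pow, Real.sq_sqrt (by norm_num)]; norm_num
  obtain ⟨a, b, ha, hab, hb, hI⟩ : ∃ a b : ℝ, 0 ≤ a ∧ a ≤ b ∧ b ≤ 1 ∧
      (∫ l in a..b, (1 - m / 2 * (l - x) ^ 2)) = t - m * t ^ 3 / 6 := by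
    have hint : ∀ a b : ℝ, (∫ l in a..b, (1 - m / 2 * (l - x) ^ 2)) =
        (b - a) - m / 6 * ((b - x) ^ 3 - (a - x) ^ 3) := by
      intro a b
      rw [intervalIntegral.integral_sub (by simp) (Continuous.intervalIntegrable (by fun_prop) _ _),
        intervalIntegral.integral_const_mul,
        intervalIntegral.integral_comp_sub_right (fun y => y ^ 2), integral_pow]
      simp
      ring
    rcases le_total x (1 / 2) with hx | hx
    · exact ⟨x, x + t, h, by linarith, by linarith, by rw [hint]; ring⟩
    · exact ⟨x - t, x, by linarith, by linarith, hx1, by rw [hint]; ring⟩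
  have hlow : Real.exp (m * (p * x ^ 2 / 2)) * (7 / 8 * t) ≤
      ∫ l in (0 : ℝ)..1, Real.exp (m * (l * (p * x) - l ^ 2 * p / 2)) := by
    calc Real.exp (m * (p * x ^ 2 / 2)) * (7 / 8 * t)
        = ∫ l in a..b, Real.exp (m * (p * x ^ 2 / 2)) * (1 - m / 2 * (l - x) ^ 2) := by
          rw [intervalIntegral.integral_const_mul, hI]
          congr 1
          linear_combination (t / 6) * hmt
      _ ≤ ∫ l in a..b, Real.exp (m * (l * (p * x) - l ^ 2 * p / 2)) := by
          refine intervalIntegral.integral_mono_on hab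
            (Continuous.intervalIntegrable (by fun_prop) _ _)
            (Continuous.intervalIntegrable (by fun_prop) _ _) fun l _ => ?_
          have e : m * (l * (p * x) - l ^ 2 * p / 2) =
              m * (p * x ^ 2 / 2) + -(m * p / 2 * (l - x) ^ 2) := by ring
          rw [e, Real.exp_add]
          gcongr
          have h1 := Real.add_one_le_exp (-(m * p / 2 * (l - x) ^ 2))
          have h2 : m * p / 2 * (l - x) ^ 2 ≤ m / 2 * (l - x) ^ 2 := by
            gcongr
            nlinarith
          linarith
      _ ≤ _ := intervalIntegral.integral_mono_interval ha hab hb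
          (ae_of_all _ fun _ => (Real.exp_pos _).le)
          (Continuous.intervalIntegrable (by fun_prop) _ _)
  have hc1 : 1 ≤ (2 * √m - 1) * (7 / 8 * t) := by nlinarith
  calc Real.exp (m * (p * x ^ 2 / 2))
      ≤ Real.exp (m * (p * x ^ 2 / 2)) * ((2 * √m - 1) * (7 / 8 * t)) :=
        le_mul_of_one_le_right (Real.exp_pos _).le hc1
    _ = (2 * √m - 1) * (Real.exp (m * (p * x ^ 2 / 2)) * (7 / 8 * t)) := by ring
    _ ≤ _ := mul_le_mul_of_nonneg_left hlow hcoef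
    _ ≤ _ := by linarith

lemma exp_quadGap_le_of_lt_three {p q : ℝ} (hp : 0 ≤ p) (hp1 : p ≤ 1) (hq : 0 ≤ q)
    {m : ℕ} (hm : 1 ≤ m) (hm3 : m < 3) : Real.exp (m * quadGap p q) ≤ 2 * √(m : ℝ) := by
  have hg := quadGap_le_half hp hp1 hq
  have he := Real.exp_one_lt_d9
  interval_cases m
  · have : Real.exp (((1 : ℕ) : ℝ) * quadGap p q) ≤ Real.exp (1 / 2) :=
      Real.exp_le_exp.2 (by simpa using hg)
    have h2 : Real.exp (1 / 2) ^ 2 = Real.exp 1 := by rw [← Real.exp_nat_mul]; norm_num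
    have h3 : Real.exp (1 / 2) ≤ 2 := by nlinarith [Real.exp_pos (1 / 2)]
    simp only [Nat.cast_one, Real.sqrt_one, mul_one] at *
    linarith
  · have h3 : (1.41 : ℝ) ≤ √2 := Real.le_sqrt_of_sq_le (by norm_num)
    calc Real.exp ((2 : ℕ) * quadGap p q) ≤ Real.exp 1 :=
          Real.exp_le_exp.2 (by push_cast; linarith)
      _ ≤ 2 * √2 := by linarith
      _ = 2 * √((2 : ℕ) : ℝ) := by norm_num

lemma lintegral_exp_quadGap_le {Z : Type*} [MeasurableSpace Z] (D : Measure Z)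
    [IsProbabilityMeasure D] {f : Z → ℝ} (hf : Measurable f) (hf01 : ∀ z, f z ∈ Set.Icc (0 : ℝ) 1)
    {m : ℕ} (hm : 1 ≤ m) :
    ∫⁻ S : Fin m → Z, ENNReal.ofReal (Real.exp (m * quadGap (∫ z, f z ∂D)
      ((1 / (m : ℝ)) * ∑ j, f (S j)))) ∂(Measure.pi fun _ : Fin m => D) ≤
        ENNReal.ofReal (2 * √m) := by
  have hp0 : 0 ≤ ∫ z, f z ∂D := integral_nonneg fun z => (hf01 z).1
  have hp1 : ∫ z, f z ∂D ≤ 1 := by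
    calc ∫ z, f z ∂D ≤ ∫ _, (1 : ℝ) ∂D :=
          integral_mono (Integrable.of_mem_Icc 0 1 hf.aemeasurable (ae_of_all _ hf01))
            (integrable_const _) fun z => (hf01 z).2
      _ = 1 := by simp
  have hq0 : ∀ S : Fin m → Z, 0 ≤ (1 / (m : ℝ)) * ∑ j, f (S j) := fun S =>
    mul_nonneg (by positivity) (Finset.sum_nonneg fun j _ => (hf01 _).1)
  rcases lt_or_ge m 3 with hm3 | hm3
  · calc _ ≤ ∫⁻ _ : Fin m → Z, ENNReal.ofReal (2 * √m) ∂(Measure.pi fun _ : Fin m => D) :=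
          lintegral_mono fun S => ENNReal.ofReal_le_ofReal
            (exp_quadGap_le_of_lt_three hp0 hp1 (hq0 S) hm hm3)
      _ = _ := by simp
  have hm3' : (3 : ℝ) ≤ m := by exact_mod_cast hm3
  have hcoef : 0 ≤ 2 * √(m : ℝ) - 1 := by
    have : 1 ≤ √(m : ℝ) := Real.one_le_sqrt.2 (by linarith)
    linarith
  have hlin := fun {l : ℝ} (hl : 0 ≤ l) => lintegral_exp_linear_le_one D hf hf01 hm hl
  generalize (∫ z, f z ∂D) = p at *
  let g : (Fin m → Z) → ℝ → ℝ := fun S l =>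
    Real.exp (m * (l * (p - (1 / (m : ℝ)) * ∑ j, f (S j)) - l ^ 2 * p / 2))
  have hgm : Measurable (Function.uncurry fun S l => ENNReal.ofReal (g S l)) := by
    simp only [g, Function.uncurry_def]
    fun_prop
  have hgm1 : Measurable fun S => ∫⁻ l in Set.Ioc (0 : ℝ) 1, ENNReal.ofReal (g S l) :=
    hgm.lintegral_prod_right'
  calc _ ≤ ∫⁻ S : Fin m → Z, (1 + ENNReal.ofReal (2 * √m - 1) *
          ∫⁻ l in Set.Ioc (0 : ℝ) 1, ENNReal.ofReal (g S l)) ∂(Measure.pi fun _ : Fin m => D) := by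
        refine lintegral_mono fun S => ?_
        rw [← ofReal_integral_eq_lintegral_ofReal
          ((intervalIntegrable_iff_integrableOn_Ioc_of_le zero_le_one).1
            (Continuous.intervalIntegrable (by fun_prop) _ _))
          (ae_of_all _ fun _ => (Real.exp_pos _).le), ← ENNReal.ofReal_mul hcoef,
          ← ENNReal.ofReal_one, ← ENNReal.ofReal_add zero_le_one,
          ← intervalIntegral.integral_of_le zero_le_one]
        · exact ENNReal.ofReal_le_ofReal (exp_quadGap_le_integral hp0 hp1 (hq0 S) hm3')
        · exact mul_nonneg hcoef (integral_nonneg fun _ => (Real.exp_pos _).le)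
    _ = 1 + ENNReal.ofReal (2 * √m - 1) * ∫⁻ l in Set.Ioc (0 : ℝ) 1, ∫⁻ S : Fin m → Z,
          ENNReal.ofReal (g S l) ∂(Measure.pi fun _ : Fin m => D) := by
        rw [lintegral_add_left measurable_const, lintegral_const_mul _ hgm1,
          lintegral_lintegral_swap hgm.aemeasurable]
        simp
    _ ≤ 1 + ENNReal.ofReal (2 * √m - 1) * ∫⁻ _ in Set.Ioc (0 : ℝ) 1, 1 := by
        gcongr 1 + _ * ?_
        exact setLIntegral_mono measurable_const fun l hl => hlin hl.1.le
    _ = ENNReal.ofReal (2 * √m) := by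
        rw [setLIntegral_one, Real.volume_Ioc, sub_zero, ENNReal.ofReal_one, mul_one,
          ← ENNReal.ofReal_one, ← ENNReal.ofReal_add zero_le_one hcoef]
        congr 1
        ring

lemma integral_le_integral_llr_add_log {α : Type*} [MeasurableSpace α] {P Q : Measure α}
    [IsProbabilityMeasure P] [IsProbabilityMeasure Q] {g : α → ℝ} (hQP : Q ≪ P)
    (hllr : Integrable (llr Q P) Q) (hg : Integrable g Q)
    (hexp : Integrable (fun x => Real.exp (g x)) P) :
    ∫ x, g x ∂Q ≤ ∫ x, llr Q P x ∂Q + Real.log (∫ x, Real.exp (g x) ∂P) := by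
  have := isProbabilityMeasure_tilted hexp
  have h := InformationTheory.integral_llr_add_sub_measure_univ_nonneg
    (hQP.trans (absolutelyContinuous_tilted hexp))
    (integrable_llr_tilted_right hQP hg hllr hexp)
  rw [integral_llr_tilted_right hQP hg hexp hllr] at h
  simp only [probReal_univ] at h
  linarith

lemma ofReal_one_sub_le_measure_lt {Ω : Type*} [MeasurableSpace Ω] (μ : Measure Ω)
    [IsProbabilityMeasure μ] {A : Ω → ℝ≥0∞} (hA : Measurable A) {b δ : ℝ} (hb : 0 < b)
    (hδ : 0 < δ) (hint : ∫⁻ x, A x ∂μ ≤ ENNReal.ofReal b) :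
    ENNReal.ofReal (1 - δ) ≤ μ {x | A x < ENNReal.ofReal (b / δ)} := by
  have hε0 : ENNReal.ofReal (b / δ) ≠ 0 := (ENNReal.ofReal_pos.2 (by positivity)).ne'
  have hbad : μ {x | ENNReal.ofReal (b / δ) ≤ A x} ≤ ENNReal.ofReal δ := by
    have h := (mul_meas_ge_le_lintegral (μ := μ) hA (ENNReal.ofReal (b / δ))).trans hint
    have e : ENNReal.ofReal b = ENNReal.ofReal (b / δ) * ENNReal.ofReal δ := by
      rw [← ENNReal.ofReal_mul (by positivity)]
      congr 1
      field_simp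
    rw [e] at h
    exact (ENNReal.mul_le_mul_iff_right hε0 ENNReal.ofReal_ne_top).1 h
  have hc : {x | A x < ENNReal.ofReal (b / δ)} = {x | ENNReal.ofReal (b / δ) ≤ A x}ᶜ := by
    ext x; simp
  rw [hc, prob_compl_eq_one_sub (measurableSet_le measurable_const hA),
    ENNReal.ofReal_sub _ hδ.le, ENNReal.ofReal_one]
  exact tsub_le_tsub_left hbad 1

lemma ofReal_le_quadratic {p q c : ℝ} (hq : 0 ≤ q) (hc : 0 ≤ c) (h : p ≤ (√(q + c) + √c) ^ 2) :
    ENNReal.ofReal p ≤ ((ENNReal.ofReal q + ENNReal.ofReal c) ^ (1 / 2 : ℝ) +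
      (ENNReal.ofReal c) ^ (1 / 2 : ℝ)) ^ (2 : ℕ) := by
  rw [← ENNReal.ofReal_add hq hc, ENNReal.ofReal_rpow_of_nonneg (by positivity) (by norm_num),
    ENNReal.ofReal_rpow_of_nonneg hc (by norm_num), ← Real.sqrt_eq_rpow, ← Real.sqrt_eq_rpow,
    ← ENNReal.ofReal_add (by positivity) (by positivity), ← ENNReal.ofReal_pow (by positivity)]
  exact ENNReal.ofReal_le_ofReal h

section Risk

variable {H Z : Type*} [MeasurableSpace H] [MeasurableSpace Z] {ℓ : H → Z → ℝ} {m : ℕ}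

lemma measurable_riskD (hℓ : Measurable fun p : H × Z => ℓ p.1 p.2) (D : Measure Z)
    [SFinite D] : Measurable (riskD ℓ D) :=
  (StronglyMeasurable.integral_prod_right (f := ℓ) hℓ.stronglyMeasurable).measurable

lemma measurable_uncurry_riskS (hℓ : Measurable fun p : H × Z => ℓ p.1 p.2) :
    Measurable fun x : (Fin m → Z) × H => riskS ℓ x.1 x.2 := by
  unfold riskS
  refine (Finset.measurable_sum _ fun j _ => ?_).const_mul _
  exact hℓ.comp (measurable_snd.prodMk ((measurable_pi_apply j).comp measurable_fst))

lemma riskD_mem_Icc {H : Type*} {ℓ : H → Z → ℝ} (hℓ : ∀ h z, ℓ h z ∈ Set.Icc (0 : ℝ) 1) (D : Measure Z)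
    [IsProbabilityMeasure D] (h : H) : riskD ℓ D h ∈ Set.Icc (0 : ℝ) 1 := by
  refine ⟨integral_nonneg fun z => (hℓ h z).1, ?_⟩
  refine (integral_mono_of_nonneg (ae_of_all _ fun z => (hℓ h z).1)
    (integrable_const (1 : ℝ)) (ae_of_all _ fun z => (hℓ h z).2)).trans ?_
  simp

lemma riskS_mem_Icc {H Z : Type*} {ℓ : H → Z → ℝ} (hℓ : ∀ h z, ℓ h z ∈ Set.Icc (0 : ℝ) 1) (S : Fin m → Z) (h : H) :
    riskS ℓ S h ∈ Set.Icc (0 : ℝ) 1 := by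
  refine ⟨mul_nonneg (by positivity) (Finset.sum_nonneg fun j _ => (hℓ h _).1), ?_⟩
  have : ∑ j, ℓ h (S j) ≤ m := by
    simpa using Finset.sum_le_sum fun j (_ : j ∈ Finset.univ) => (hℓ h (S j)).2
  unfold riskS
  rw [one_div, inv_mul_eq_div]
  exact div_le_one_of_le₀ this (by positivity)

lemma measurable_exp_quadGap (hℓ : Measurable fun p : H × Z => ℓ p.1 p.2) (D : Measure Z)
    [SFinite D] : Measurable fun x : (Fin m → Z) × H =>
      ENNReal.ofReal (Real.exp (m * quadGap (riskD ℓ D x.2) (riskS ℓ x.1 x.2))) := by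
  have h1 : Measurable fun x : (Fin m → Z) × H => riskD ℓ D x.2 :=
    (measurable_riskD hℓ D).comp measurable_snd
  have h2 := measurable_uncurry_riskS (m := m) hℓ
  unfold quadGap
  fun_prop

lemma riskDQ_le_of_lintegral_lt (hℓmeas : Measurable fun p : H × Z => ℓ p.1 p.2)
    (hℓ : ∀ h z, ℓ h z ∈ Set.Icc (0 : ℝ) 1) (D : Measure Z) [IsProbabilityMeasure D]
    (hm : 1 ≤ m) (P : Measure H) [IsProbabilityMeasure P] {B : ℝ} {S : Fin m → Z}
    (hS : ∫⁻ h, ENNReal.ofReal (Real.exp (m * quadGap (riskD ℓ D h) (riskS ℓ S h))) ∂P <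
      ENNReal.ofReal B) (Q : Measure H) [IsProbabilityMeasure Q] :
    ENNReal.ofReal (riskDQ ℓ D Q) ≤
      ((ENNReal.ofReal (riskSQ ℓ S Q) +
          (klDiv' Q P + ENNReal.ofReal (Real.log B)) / (2 * (m : ℝ≥0∞))) ^ (1 / 2 : ℝ) +
        ((klDiv' Q P + ENNReal.ofReal (Real.log B)) / (2 * (m : ℝ≥0∞))) ^ (1 / 2 : ℝ)) ^
          (2 : ℕ) := by
  have hm0 : (0 : ℝ) < m := by exact_mod_cast hm
  by_cases hQ : Q ≪ P ∧ Integrable (fun x => Real.log (Q.rnDeriv P x).toReal) Q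
  swap
  · have htop : (∞ : ℝ≥0∞) / (2 * (m : ℝ≥0∞)) = ∞ :=
      ENNReal.top_div_of_ne_top (ENNReal.mul_ne_top (by simp) (by simp))
    simp [klDiv', hQ, htop]
  obtain ⟨hQP, hllr⟩ := hQ
  rw [klDiv', if_pos ⟨hQP, hllr⟩]
  set K := ∫ x, Real.log (Q.rnDeriv P x).toReal ∂Q
  set c : ℝ := (max K 0 + max (Real.log B) 0) / (2 * m) with hc
  have hc0 : 0 ≤ c := by positivity
  have hcE : (ENNReal.ofReal K + ENNReal.ofReal (Real.log B)) / (2 * (m : ℝ≥0∞)) =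
      ENNReal.ofReal c := by
    rw [hc, ENNReal.ofReal_div_of_pos (by positivity), ENNReal.ofReal_add (by positivity)
      (by positivity), ENNReal.ofReal_mul (by norm_num)]
    simp
  have hDm := measurable_riskD hℓmeas D
  have hSm : Measurable (riskS ℓ S) :=
    (measurable_uncurry_riskS hℓmeas).comp (measurable_const.prodMk measurable_id)
  have hDi : Integrable (riskD ℓ D) Q :=
    Integrable.of_mem_Icc 0 1 hDm.aemeasurable (ae_of_all _ (riskD_mem_Icc hℓ D))
  have hSi : Integrable (riskS ℓ S) Q :=
    Integrable.of_mem_Icc 0 1 hSm.aemeasurable (ae_of_all _ (riskS_mem_Icc hℓ S))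
  have hp : 0 ≤ riskDQ ℓ D Q := integral_nonneg fun h => (riskD_mem_Icc hℓ D h).1
  have hq : 0 ≤ riskSQ ℓ S Q := integral_nonneg fun h => (riskS_mem_Icc hℓ S h).1
  rw [hcE]
  refine ofReal_le_quadratic hq hc0 (le_sq_sqrt_add_sqrt hp hq hc0 fun l hl => ?_)
  set g : H → ℝ := fun h => m * quadGap (riskD ℓ D h) (riskS ℓ S h) with hg
  have hgm : Measurable g := by
    simp only [hg, quadGap]
    fun_prop
  have hgIcc : ∀ h, g h ∈ Set.Icc (0 : ℝ) m := fun h => by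
    obtain ⟨h0, h1⟩ := riskD_mem_Icc hℓ D h
    have h2 := (riskS_mem_Icc hℓ S h).1
    refine ⟨mul_nonneg hm0.le (quadGap_nonneg h0 _), mul_le_of_le_one_right hm0.le ?_⟩
    linarith [quadGap_le_half h0 h1 h2]
  have hgi : Integrable g Q := Integrable.of_mem_Icc 0 m hgm.aemeasurable (ae_of_all _ hgIcc)
  have hexp : Integrable (fun h => Real.exp (g h)) P :=
    Integrable.of_mem_Icc 0 (Real.exp m) (by fun_prop) (ae_of_all _ fun h =>
      ⟨(Real.exp_pos _).le, Real.exp_le_exp.2 (hgIcc h).2⟩)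
  have hlog : Real.log (∫ h, Real.exp (g h) ∂P) ≤ Real.log B := by
    rw [← ofReal_integral_eq_lintegral_ofReal hexp (ae_of_all _ fun _ => (Real.exp_pos _).le)]
      at hS
    exact Real.log_le_log (integral_exp_pos hexp)
      ((ENNReal.ofReal_lt_ofReal_iff_of_nonneg (integral_exp_pos hexp).le).1 hS).le
  have hdv : ∫ h, g h ∂Q ≤ K + Real.log (∫ h, Real.exp (g h) ∂P) :=
    integral_le_integral_llr_add_log hQP hllr hgi hexp
  have hlow : m * (l * (riskDQ ℓ D Q - riskSQ ℓ S Q) - l ^ 2 * riskDQ ℓ D Q / 2) ≤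
      ∫ h, g h ∂Q := by
    have e : m * (l * (riskDQ ℓ D Q - riskSQ ℓ S Q) - l ^ 2 * riskDQ ℓ D Q / 2) =
        ∫ h, m * (l * (riskD ℓ D h - riskS ℓ S h) - l ^ 2 * riskD ℓ D h / 2) ∂Q := by
      rw [integral_const_mul, integral_sub (f := fun h => l * (riskD ℓ D h - riskS ℓ S h))
        ((hDi.sub hSi).const_mul l) ((hDi.const_mul _).div_const 2), integral_const_mul, integral_sub hDi hSi,
        integral_div, integral_const_mul]
      rfl
    rw [e]
    refine integral_mono ((((hDi.sub hSi).const_mul l).sub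
      ((hDi.const_mul _).div_const 2)).const_mul _) hgi fun h => ?_
    exact mul_le_mul_of_nonneg_left (mul_sub_le_quadGap (riskD_mem_Icc hℓ D h).1
      (riskS_mem_Icc hℓ S h).1 hl) hm0.le
  have hcm : m * (2 * c) = max K 0 + max (Real.log B) 0 := by rw [hc]; field_simp
  refine le_of_mul_le_mul_left ?_ hm0
  rw [hcm]
  linarith [le_max_left K 0, le_max_left (Real.log B) 0]

end Risk

/-- **PAC-Bayes quadratic bound.** With probability at least `1 − δ` over `S ~ D^⊗m`,
simultaneously for every posterior `Q`, writing `c = (KL(Q‖P) + ln(2√m/δ))/(2m)`,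
`R_D(Q) ≤ (√(R̂_S(Q) + c) + √c)²`. -/
theorem pac_bayes_quadratic_bound
    {H Z : Type*} [MeasurableSpace H] [MeasurableSpace Z]
    (ℓ : H → Z → ℝ) (hℓmeas : Measurable fun p : H × Z => ℓ p.1 p.2)
    (hℓbdd : ∀ h z, ℓ h z ∈ Set.Icc (0 : ℝ) 1)
    (D : Measure Z) [IsProbabilityMeasure D]
    (m : ℕ) (hm : 1 ≤ m)
    (P : Measure H) [IsProbabilityMeasure P]
    (δ : ℝ) (hδ : δ ∈ Set.Ioo (0 : ℝ) 1) :
    ENNReal.ofReal (1 - δ) ≤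
      (Measure.pi fun _ : Fin m => D)
        {S | ∀ Q : Measure H, IsProbabilityMeasure Q →
          ENNReal.ofReal (riskDQ ℓ D Q) ≤
            ((ENNReal.ofReal (riskSQ ℓ S Q) +
                (klDiv' Q P + ENNReal.ofReal (Real.log (2 * Real.sqrt m / δ))) /
                  (2 * (m : ℝ≥0∞))) ^ (1 / 2 : ℝ) +
              ((klDiv' Q P + ENNReal.ofReal (Real.log (2 * Real.sqrt m / δ))) /
                  (2 * (m : ℝ≥0∞))) ^ (1 / 2 : ℝ)) ^ (2 : ℕ)} := by
  have hsm : 0 < 2 * Real.sqrt m := by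
    have : (0 : ℝ) < m := by exact_mod_cast hm
    positivity
  have hmeas := measurable_exp_quadGap (m := m) hℓmeas D
  have hint : ∫⁻ S : Fin m → Z, ∫⁻ h, ENNReal.ofReal
      (Real.exp (m * quadGap (riskD ℓ D h) (riskS ℓ S h))) ∂P ∂(Measure.pi fun _ : Fin m => D) ≤
        ENNReal.ofReal (2 * Real.sqrt m) := by
    rw [lintegral_lintegral_swap hmeas.aemeasurable]
    calc _ ≤ ∫⁻ _ : H, ENNReal.ofReal (2 * Real.sqrt m) ∂P := lintegral_mono fun h =>
          lintegral_exp_quadGap_le D (hℓmeas.comp measurable_prodMk_left) (hℓbdd h) hm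
      _ = _ := by simp
  refine (ofReal_one_sub_le_measure_lt _ hmeas.lintegral_prod_right' hsm hδ.1 hint).trans
    (measure_mono fun S hS Q _ => ?_)
  exact riskDQ_le_of_lintegral_lt hℓmeas hℓbdd D hm P hS Q
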